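/- arXiv:2602.08757 — 4 statements merged into one kernel-verified Lean document; each statement's English description precedes it below -/
import Mathlib

section
/- With the explicit single-track matrices, if l₁C̃₁ ≠ l₂C̃₂ then the pair (Ã₁, C) with C = [0 1] is observable; equivalently, the 2×2 observability matrix whose rows are C and C·Ã₁ is invertible. -/
/- Single-track data: the explicit matrices of the linearized single-track
   vehicle model, and the notion of Hurwitz matrix. -/

open Matrix

noncomputable section

/-- A real square matrix is Hurwitz if every complex eigenvalue has
strictly negative real part. -/
def IsHurwitz {n : Type*} [Fintype n] [DecidableEq n] (A : Matrix n n ℝ) : Prop :=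
  ∀ μ ∈ spectrum ℂ (A.map (fun x : ℝ => (x : ℂ))), μ.re < 0

/-- The linearized single-track system matrix
Ã₁ = A₁ + G₁·C̃·A₂, with A₁ = [[0,−1],[0,0]],
G₁ = −[[1/(m vₓ), 1/(m vₓ)],[l₁/I_z, −l₂/I_z]], C̃ = diag(C̃₁,C̃₂),
A₂ = [[1, l₁/vₓ],[1, −l₂/vₓ]]. -/
def Atil (m Iz vx l₁ l₂ C₁ C₂ : ℝ) : Matrix (Fin 2) (Fin 2) ℝ :=
  !![0, -1; 0, 0]
    + (-(!![1/(m*vx), 1/(m*vx); l₁/Iz, -(l₂/Iz)]))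
      * !![C₁, 0; 0, C₂]
      * !![1, l₁/vx; 1, -(l₂/vx)]

/-- The output matrix C = [0 1]. -/
def Cmat : Matrix (Fin 1) (Fin 2) ℝ := !![0, 1]

/-- The determinant of the observability matrix with rows `C` and `C * Ã₁`. -/
theorem det_observability (m Iz vx l₁ l₂ C₁ C₂ : ℝ) :
    (Matrix.of ![Cmat 0, (Cmat * Atil m Iz vx l₁ l₂ C₁ C₂) 0]
        : Matrix (Fin 2) (Fin 2) ℝ).det = (l₁ * C₁ - l₂ * C₂) / Iz := by
  simp [Matrix.det_fin_two, Cmat, Atil]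
  ring

/-- if l₁C̃₁ ≠ l₂C̃₂ then the pair (Ã₁, C) with C = [0 1] is
observable: the 2×2 observability matrix with rows C and C·Ã₁ has rank 2,
equivalently it is invertible. -/
theorem statement9
    (m Iz vx l₁ l₂ C₁ C₂ : ℝ)
    (hm : 0 < m) (hIz : 0 < Iz) (hvx : 0 < vx) (hl₁ : 0 < l₁) (hl₂ : 0 < l₂)
    (hne : l₁ * C₁ ≠ l₂ * C₂) :
    (Matrix.of ![Cmat 0, (Cmat * Atil m Iz vx l₁ l₂ C₁ C₂) 0]
        : Matrix (Fin 2) (Fin 2) ℝ).rank = 2 ∧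
      IsUnit (Matrix.of ![Cmat 0, (Cmat * Atil m Iz vx l₁ l₂ C₁ C₂) 0]
        : Matrix (Fin 2) (Fin 2) ℝ) := by
  have h : IsUnit (Matrix.of ![Cmat 0, (Cmat * Atil m Iz vx l₁ l₂ C₁ C₂) 0]
      : Matrix (Fin 2) (Fin 2) ℝ) := by
    rw [Matrix.isUnit_iff_isUnit_det, det_observability, isUnit_iff_ne_zero]
    exact div_ne_zero (sub_ne_zero.mpr hne) hIz.ne'
  exact ⟨by simpa using Matrix.rank_of_isUnit _ h, h⟩
end
end

section
/- With the explicit single-track matrices, if l₁C̃₁ = l₂C̃₂ > 0 then the matrix Ã₁ is Hurwitz, i.e., every complex eigenvalue of Ã₁ has strictly negative real part. -/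
/- Single-track data: the explicit matrices of the linearized single-track
   vehicle model, and the notion of Hurwitz matrix. -/

open Matrix

noncomputable section

/-- A real upper triangular `2 × 2` matrix with negative diagonal entries is Hurwitz. -/
theorem isHurwitz_of_upperTriangular {a b d : ℝ} (ha : a < 0) (hd : d < 0) :
    IsHurwitz !![a, b; 0, d] := by
  intro μ hμ
  rw [spectrum.mem_iff, Matrix.isUnit_iff_isUnit_det, isUnit_iff_ne_zero, not_not,
    Matrix.det_fin_two] at hμ
  have h : (μ - a) * (μ - d) = 0 := by
    simpa [Matrix.algebraMap_matrix_apply] using hμ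
  rcases mul_eq_zero.mp h with h | h
  · rw [sub_eq_zero.mp h]
    exact_mod_cast ha
  · rw [sub_eq_zero.mp h]
    exact_mod_cast hd

/-- If `l₁ * C₁ = l₂ * C₂`, the single-track matrix is upper triangular. -/
theorem Atil_eq_upperTriangular {m Iz vx l₁ l₂ C₁ C₂ : ℝ} (heq : l₁ * C₁ = l₂ * C₂) :
    Atil m Iz vx l₁ l₂ C₁ C₂ =
      !![-((C₁ + C₂) / (m * vx)), -1; 0, -(l₁ * C₁ * (l₁ + l₂) / (Iz * vx))] := by
  ext i j
  fin_cases i <;> fin_cases j <;> simp [Atil]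
  · ring
  · linear_combination (-(1 / (m * vx)) * (1 / vx)) * heq
  · linear_combination (-(1 / Iz)) * heq
  · linear_combination (l₂ / (Iz * vx)) * heq

/-- if l₁C̃₁ = l₂C̃₂ > 0 then the linearized single-track matrix Ã₁
is Hurwitz. -/
theorem statement10
    (m Iz vx l₁ l₂ C₁ C₂ : ℝ)
    (hm : 0 < m) (hIz : 0 < Iz) (hvx : 0 < vx) (hl₁ : 0 < l₁) (hl₂ : 0 < l₂)
    (heq : l₁ * C₁ = l₂ * C₂) (hpos : 0 < l₁ * C₁) :
    IsHurwitz (Atil m Iz vx l₁ l₂ C₁ C₂) := by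
  have hC₁ : 0 < C₁ := pos_of_mul_pos_right hpos hl₁.le
  have hC₂ : 0 < C₂ := pos_of_mul_pos_right (heq ▸ hpos) hl₂.le
  rw [Atil_eq_upperTriangular heq]
  exact isHurwitz_of_upperTriangular (neg_neg_of_pos (by positivity))
    (neg_neg_of_pos (by positivity))
end
end

section
/- With the explicit single-track matrices, if C̃₁ > 0, C̃₂ > 0 and the understeer inequality l₁C̃₁ < l₂C̃₂ holds, then for every longitudinal speed v_x > 0 the matrix Ã₁ is Hurwitz, i.e., every complex eigenvalue of Ã₁ has strictly negative real part. -/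
/- Single-track data: the explicit matrices of the linearized single-track
   vehicle model, and the notion of Hurwitz matrix. -/

open Matrix

noncomputable section

/-- A real `2 × 2` matrix with negative trace and positive determinant is Hurwitz. -/
theorem isHurwitz_of_trace_neg_of_det_pos {A : Matrix (Fin 2) (Fin 2) ℝ}
    (htr : A.trace < 0) (hdet : 0 < A.det) : IsHurwitz A := by
  intro μ hμ
  rw [Matrix.mem_spectrum_iff_isRoot_charpoly, Polynomial.IsRoot.def,
    Matrix.eval_charpoly] at hμ
  rw [Matrix.trace_fin_two] at htr
  rw [Matrix.det_fin_two] at hμ hdet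
  have hre := congrArg Complex.re hμ
  have him := congrArg Complex.im hμ
  simp at hre him
  by_contra! hx
  have hfac : μ.im * (2 * μ.re - (A 0 0 + A 1 1)) = 0 := by linarith
  have hy : μ.im = 0 := (mul_eq_zero.mp hfac).resolve_right (by linarith)
  rw [hy] at hre
  nlinarith [mul_nonneg hx (neg_nonneg.mpr htr.le), mul_nonneg hx hx]

theorem trace_Atil (m Iz vx l₁ l₂ C₁ C₂ : ℝ) :
    (Atil m Iz vx l₁ l₂ C₁ C₂).trace =
      -((C₁ + C₂) / (m * vx) + (l₁ ^ 2 * C₁ + l₂ ^ 2 * C₂) / (Iz * vx)) := by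
  simp [Atil, Matrix.trace_fin_two]
  ring

theorem det_Atil (m Iz vx l₁ l₂ C₁ C₂ : ℝ) :
    (Atil m Iz vx l₁ l₂ C₁ C₂).det =
      C₁ * C₂ * (l₁ + l₂) ^ 2 / (m * Iz * vx ^ 2) + (l₂ * C₂ - l₁ * C₁) / Iz := by
  simp [Atil, Matrix.det_fin_two]
  ring

/-- if C̃₁ > 0, C̃₂ > 0 and the understeer inequality
l₁C̃₁ < l₂C̃₂ holds, then for every longitudinal speed vₓ > 0 the linearized
single-track matrix Ã₁ is Hurwitz. -/
theorem statement11
    (m Iz l₁ l₂ C₁ C₂ : ℝ)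
    (hm : 0 < m) (hIz : 0 < Iz) (hl₁ : 0 < l₁) (hl₂ : 0 < l₂)
    (hC₁ : 0 < C₁) (hC₂ : 0 < C₂) (hund : l₁ * C₁ < l₂ * C₂) :
    ∀ vx : ℝ, 0 < vx → IsHurwitz (Atil m Iz vx l₁ l₂ C₁ C₂) := by
  intro vx hvx
  apply isHurwitz_of_trace_neg_of_det_pos
  · rw [trace_Atil, neg_lt_zero]
    positivity
  · rw [det_Atil]
    have hD : 0 < l₂ * C₂ - l₁ * C₁ := sub_pos.mpr hund
    positivity
end
end

section
/- Let γ₀, η₉, γ₁ > 0 satisfy η₉γ₁ < γ₀. Then there exists r > 0 such that: setting γ = γ₀ − η₉(√r + γ₁) > 0, for every T ∈ (0,∞] and every differentiable function V : [0,T) → [0,∞) with V(0) < r and with V′(t) ≤ −γ₀ V(t) + η₉ V(t)^{1/2} ( V(t) + γ₁ V(t)^{1/2} ) at every t ∈ [0,T) for which V(t) < r, one has V(t) < r and V(t) ≤ V(0) e^{−γ t} for all t ∈ [0,T). -/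
open Set
open scoped ENNReal

/-- A barrier argument followed by Grönwall: if `V' ≤ -γ V` wherever `V < r`, then `V` stays below
`r` once it starts there, and it decays exponentially. -/
theorem lt_and_le_mul_exp_of_deriv_le_of_lt {V V' : ℝ → ℝ} {γ r t : ℝ} (hγ : 0 < γ)
    (ht : 0 ≤ t) (hV : ∀ x ∈ Icc 0 t, HasDerivWithinAt V (V' x) (Icc 0 t) x)
    (hV0 : 0 ≤ V 0) (h0 : V 0 < r)
    (hle : ∀ x ∈ Icc 0 t, V x < r → V' x ≤ -γ * V x) :
    V t < r ∧ V t ≤ V 0 * Real.exp (-γ * t) := by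
  have hcont : ContinuousOn V (Icc 0 t) := fun x hx => (hV x hx).continuousWithinAt
  have hright : ∀ x ∈ Ico 0 t, HasDerivWithinAt V (V' x) (Ici x) x := fun x hx =>
    (hV x (Ico_subset_Icc_self hx)).mono_of_mem_nhdsWithin
      (Filter.mem_of_superset (Icc_mem_nhdsGE hx.2) (Icc_subset_Icc_left hx.1))
  have hbarrier : ∀ x ∈ Icc 0 t, V x ≤ (V 0 + r) / 2 := fun x hx =>
    image_le_of_deriv_right_lt_deriv_boundary' (B := fun _ => (V 0 + r) / 2) (B' := fun _ => 0)
      hcont hright (by linarith) continuousOn_const (fun x _ => hasDerivWithinAt_const ..)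
      (fun x hx hx' => by
        have := hle x (Ico_subset_Icc_self hx) (by linarith)
        have : 0 < γ * V x := mul_pos hγ (by linarith)
        linarith) hx
  have hlt : ∀ x ∈ Icc 0 t, V x < r := fun x hx => by linarith [hbarrier x hx]
  have hexp : ∀ x, HasDerivAt (fun y => Real.exp (γ * y)) (Real.exp (γ * x) * γ) x := fun x => by
    simpa using ((hasDerivAt_id x).const_mul γ).exp
  have hmul : V t * Real.exp (γ * t) ≤ V 0 :=
    image_le_of_deriv_right_le_deriv_boundary (f := fun y => V y * Real.exp (γ * y))
      (B := fun _ => V 0) (B' := fun _ => 0)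
      (hcont.mul (by fun_prop)) (fun x hx => (hright x hx).mul (hexp x).hasDerivWithinAt)
      (by simp) continuousOn_const (fun x _ => hasDerivWithinAt_const ..)
      (fun x hx => by
        have hx := Ico_subset_Icc_self hx
        nlinarith [hle x hx (hlt x hx), Real.exp_pos (γ * x)]) (right_mem_Icc.2 ht)
  refine ⟨hlt t (right_mem_Icc.2 ht), ?_⟩
  rwa [neg_mul, Real.exp_neg, ← div_eq_mul_inv, le_div_iff₀ (Real.exp_pos _)]

/-- comparison/Grönwall argument: if η₉γ₁ < γ₀ with γ₀, η₉, γ₁ > 0,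
then there is r > 0 such that, with γ = γ₀ − η₉(√r + γ₁) > 0, every differentiable
V : [0,T) → [0,∞) (T ∈ (0,∞]) with V(0) < r and
V' ≤ −γ₀V + η₉√V (V + γ₁√V) wherever V < r, stays below r and satisfies
V(t) ≤ V(0) e^{−γt} on [0,T). The interval [0,T) is encoded as
{t : ℝ | 0 ≤ t ∧ ENNReal.ofReal t < T} with T : ℝ≥0∞. -/
theorem statement13 (γ₀ η₉ γ₁ : ℝ) (hγ₀ : 0 < γ₀) (hη₉ : 0 < η₉) (hγ₁ : 0 < γ₁)
    (hlt : η₉ * γ₁ < γ₀) :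
    ∃ r : ℝ, 0 < r ∧ 0 < γ₀ - η₉ * (Real.sqrt r + γ₁) ∧
      ∀ T : ℝ≥0∞, 0 < T →
      ∀ V V' : ℝ → ℝ,
        -- V is differentiable on [0,T) with derivative V'
        (∀ t : ℝ, 0 ≤ t → ENNReal.ofReal t < T →
          HasDerivWithinAt V (V' t) {u : ℝ | 0 ≤ u ∧ ENNReal.ofReal u < T} t) →
        -- V takes values in [0,∞)
        (∀ t : ℝ, 0 ≤ t → ENNReal.ofReal t < T → 0 ≤ V t) →
        V 0 < r →
        -- the differential inequality, at every t ∈ [0,T) with V(t) < r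
        (∀ t : ℝ, 0 ≤ t → ENNReal.ofReal t < T → V t < r →
          V' t ≤ -γ₀ * V t + η₉ * Real.sqrt (V t) * (V t + γ₁ * Real.sqrt (V t))) →
        ∀ t : ℝ, 0 ≤ t → ENNReal.ofReal t < T →
          V t < r ∧
          V t ≤ V 0 * Real.exp (-(γ₀ - η₉ * (Real.sqrt r + γ₁)) * t) := by
  have hd : 0 < (γ₀ - η₉ * γ₁) / (2 * η₉) := div_pos (by linarith) (by linarith)
  have hγ : 0 < γ₀ - η₉ * (Real.sqrt (((γ₀ - η₉ * γ₁) / (2 * η₉)) ^ 2) + γ₁) := by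
    rw [Real.sqrt_sq hd.le]
    have : η₉ * ((γ₀ - η₉ * γ₁) / (2 * η₉)) = (γ₀ - η₉ * γ₁) / 2 := by field_simp
    linarith
  refine ⟨((γ₀ - η₉ * γ₁) / (2 * η₉)) ^ 2, by positivity, hγ, ?_⟩
  intro T hT V V' hV hnonneg h0 hineq t ht htT
  have hxT : ∀ x ∈ Icc 0 t, ENNReal.ofReal x < T := fun x hx =>
    (ENNReal.ofReal_le_ofReal hx.2).trans_lt htT
  refine lt_and_le_mul_exp_of_deriv_le_of_lt hγ ht
    (fun x hx => (hV x hx.1 (hxT x hx)).mono fun y hy => ⟨hy.1, hxT y hy⟩)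
    (hnonneg 0 le_rfl (by simpa using hT)) h0 fun x hx hxr => ?_
  have hVx := hnonneg x hx.1 (hxT x hx)
  refine (hineq x hx.1 (hxT x hx) hxr).trans ?_
  have hsqrt := mul_le_mul_of_nonneg_left (Real.sqrt_le_sqrt hxr.le) (mul_nonneg hη₉.le hVx)
  linear_combination hsqrt + η₉ * γ₁ * Real.mul_self_sqrt hVx
end
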